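/- arXiv:1607.01377 — 3 statements merged into one kernel-verified Lean document; each statement's English description precedes it below -/
import Mathlib

section
/- (Erdős–Rado) If λ is an infinite cardinal and r < ω, then (2^λ_r)^+ → (λ^+)^{r+1}_λ: for every function F : [(2^λ_r)^+]^{r+1} → λ (where (2^λ_r)^+ is viewed as a set of ordinals and [S]^{r+1} denotes the (r+1)-element subsets of S), there is a set X ⊆ (2^λ_r)^+ with |X| = λ^+ such that F is constant on [X]^{r+1}. -/
open Cardinal

universe u

/-- Iterated cardinal exponentiation: `2^λ_0 = λ` and `2^λ_{r+1} = 2 ^ (2^λ_r)`. -/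
def iterExp (lam : Cardinal.{u}) : ℕ → Cardinal.{u}
  | 0 => lam
  | r + 1 => 2 ^ iterExp lam r

theorem le_iterExp (lam : Cardinal.{u}) (r : ℕ) : lam ≤ iterExp lam r := by
  induction r with
  | zero => exact le_rfl
  | succ r ih => exact ih.trans (cantor _).le

theorem mk_finset_le_of_mk_le {α : Type u} {κ : Cardinal.{u}} (hκ : ℵ₀ ≤ κ) (h : #α ≤ κ) :
    #(Finset α) ≤ κ := by
  cases finite_or_infinite α with
  | inl _ => exact (mk_le_aleph0 (α := Finset α)).trans hκ
  | inr _ => rwa [mk_finset_of_infinite]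

section EndHomogeneous

variable {A C I : Type u} [LinearOrder I]

open Classical in
/-- The sequence following the branch of `a` in the Erdős–Rado tree of the coloring `F`: its
`i`-th term is a new point having the same colors as `a` over the earlier terms. It depends on `a`
only through these colors. -/
noncomputable def branch [WellFoundedLT I] [Nonempty A] (F : Finset A → C) (a : A) (i : I) : A :=
  Classical.epsilon fun x => (∀ j : Set.Iio i, x ≠ branch F a j.1) ∧
    ∀ t : Finset (Set.Iio i), F (insert x (t.image fun j => branch F a j.1)) =
      F (insert a (t.image fun j => branch F a j.1))
termination_by (wellFounded_lt (α := I)).wrap i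
decreasing_by all_goals exact j.2

open Classical in
theorem branch_eq_branch [WellFoundedLT I] [Nonempty A] (F : Finset A → C) {a a' : A} {i : I}
    (h : ∀ t : Finset (Set.Iio i), F (insert a (t.image fun j => branch F a j.1)) =
      F (insert a' (t.image fun j => branch F a' j.1))) {j : I} (hj : j ≤ i) :
    branch F a j = branch F a' j := by
  induction j using WellFoundedLT.induction with
  | ind j ih =>
    have hlt (k : Set.Iio j) : branch F a k.1 = branch F a' k.1 := ih k.1 k.2 (k.2.le.trans hj)
    have hcol (t : Finset (Set.Iio j)) :
        F (insert a (t.image fun k => branch F a' k.1)) =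
          F (insert a' (t.image fun k => branch F a' k.1)) := by
      have := h (t.image fun k => ⟨k.1, k.2.trans_le hj⟩)
      simp only [Finset.image_image, Function.comp_def] at this
      simpa only [hlt] using this
    rw [branch, branch]
    simp only [hlt, hcol]

open Classical in
theorem branch_spec [WellFoundedLT I] [Nonempty A] (F : Finset A → C) {a : A} (ha : ∀ i : I, branch F a i ≠ a)
    (i : I) : (∀ j : Set.Iio i, branch F a i ≠ branch F a j.1) ∧
    ∀ t : Finset (Set.Iio i), F (insert (branch F a i) (t.image fun j => branch F a j.1)) =
      F (insert a (t.image fun j => branch F a j.1)) := by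
  have := Classical.epsilon_spec (p := fun x => (∀ j : Set.Iio i, x ≠ branch F a j.1) ∧
    ∀ t : Finset (Set.Iio i), F (insert x (t.image fun j => branch F a j.1)) =
      F (insert a (t.image fun j => branch F a j.1)))
    ⟨a, fun j => (ha j.1).symm, fun _ => rfl⟩
  rwa [← branch] at this

theorem exists_forall_branch_ne [WellFoundedLT I] [Nonempty A] (F : Finset A → C)
    (h : #(Σ i : I, Finset (Set.Iio i) → C) < #A) : ∃ a, ∀ i : I, branch F a i ≠ a := by
  classical
  by_contra! H
  choose i hi using H
  let code (a : A) : Σ i : I, Finset (Set.Iio i) → C :=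
    ⟨i a, fun t => F (insert a (t.image fun j => branch F a j.1))⟩
  refine h.not_ge (mk_le_of_injective (f := code) fun a a' haa => ?_)
  obtain ⟨h₁, h₂⟩ := Sigma.mk.inj haa
  have key (k : I) (hk : i a = k)
      (hc : HEq (fun t : Finset (Set.Iio (i a)) =>
          F (insert a (t.image fun j => branch F a j.1)))
        (fun t : Finset (Set.Iio k) =>
          F (insert a' (t.image fun j => branch F a' j.1)))) :
      branch F a k = branch F a' k := by
    subst hk
    exact branch_eq_branch F (congrFun (eq_of_heq hc)) le_rfl
  have := key _ h₁ h₂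
  rwa [hi a', ← h₁, hi a] at this

open Classical in
/-- A coloring of the finite subsets of a large enough set is end-homogeneous along some injective
well-ordered sequence: the color of a set of terms does not depend on its last term. -/
theorem exists_endHomogeneous [WellFoundedLT I] (F : Finset A → C)
    (h : #(Σ i : I, Finset (Set.Iio i) → C) < #A) :
    ∃ (b : I → A) (G : Finset I → C), Function.Injective b ∧
      ∀ (i : I) (t : Finset I), (∀ j ∈ t, j < i) → F ((insert i t).image b) = G t := by
  have : Nonempty A := mk_ne_zero_iff.1 (pos_of_gt h).ne'
  obtain ⟨a, ha⟩ := exists_forall_branch_ne F h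
  refine ⟨branch F a, fun t => F (insert a (t.image (branch F a))), ?_, fun i t ht => ?_⟩
  · have hne {j i : I} (hji : j < i) : branch F a i ≠ branch F a j :=
      (branch_spec F ha i).1 ⟨j, hji⟩
    intro i j hij
    by_contra hij'
    exact (lt_or_gt_of_ne hij').elim (fun h => hne h hij.symm) fun h => hne h hij
  · have := (branch_spec F ha i).2 (t.attach.image fun j => ⟨j.1, ht j.1 j.2⟩)
    have himg : ((t.attach.image fun j => (⟨j.1, ht j.1 j.2⟩ : Set.Iio i)).image
        fun j => branch F a j.1) = t.image (branch F a) := by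
      conv_rhs => rw [← t.attach_image_val]
      simp only [Finset.image_image, Function.comp_def]
    rwa [himg, ← Finset.image_insert] at this

end EndHomogeneous

theorem mk_sigma_finset_Iio_lt {C : Type u} {κ : Cardinal.{u}} (hκ : ℵ₀ ≤ κ) (hC : #C ≤ κ) :
    #(Σ i : (Order.succ κ).ord.ToType, Finset (Set.Iio i) → C) < Order.succ (2 ^ κ) := by
  rw [Order.lt_succ_iff, mk_sigma]
  have hterm (i : (Order.succ κ).ord.ToType) : #(Finset (Set.Iio i) → C) ≤ 2 ^ κ := by
    have hi : #(Finset (Set.Iio i)) ≤ κ :=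
      mk_finset_le_of_mk_le hκ (Order.lt_succ_iff.1 (by simpa using mk_Iio_lt i (by simp)))
    calc #(Finset (Set.Iio i) → C) = #C ^ #(Finset (Set.Iio i)) := by simp
      _ ≤ κ ^ κ := (power_le_power_right hC).trans
        (power_le_power_left (aleph0_pos.trans_le hκ).ne' hi)
      _ = 2 ^ κ := power_self_eq hκ
  calc _ ≤ Cardinal.sum fun _ : (Order.succ κ).ord.ToType => (2 : Cardinal.{u}) ^ κ :=
        sum_le_sum _ _ hterm
    _ = Order.succ κ * 2 ^ κ := by simp
    _ ≤ 2 ^ κ * 2 ^ κ := by gcongr; exact Order.succ_le_of_lt (cantor κ)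
    _ = 2 ^ κ := mul_eq_self (hκ.trans (cantor κ).le)

/-- The Erdős–Rado theorem `(2^λ_r)⁺ → (λ⁺)^{r+1}_λ`: if `A` has cardinality
`(2^λ_r)⁺` and `F` colors the `(r+1)`-element subsets of `A` with `λ` colors, then
there is `X ⊆ A` with `|X| = λ⁺` such that `F` is constant on `[X]^{r+1}`. -/
theorem erdos_rado {A C : Type u} (lam : Cardinal.{u}) (hlam : aleph0 ≤ lam) (r : ℕ)
    (hA : #A = Order.succ (iterExp lam r)) (hC : #C = lam) (F : Finset A → C) :
    ∃ X : Set A, #X = Order.succ lam ∧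
      ∀ s t : Finset A, ↑s ⊆ X → ↑t ⊆ X → s.card = r + 1 → t.card = r + 1 →
        F s = F t := by
  classical
  induction r generalizing A with
  | zero =>
    have hA' : #A = Order.succ lam := hA
    obtain ⟨c, hc⟩ := infinite_pigeonhole_card (fun a : A => F {a}) (Order.succ lam) hA'.ge
      (hlam.trans (Order.le_succ lam))
      (by rw [(isRegular_succ hlam).cof_ord, hC]; exact Order.lt_succ lam)
    refine ⟨_, le_antisymm (hA' ▸ mk_set_le _) hc, fun s t hs ht hs₁ ht₁ => ?_⟩
    obtain ⟨x, rfl⟩ := Finset.card_eq_one.1 hs₁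
    obtain ⟨y, rfl⟩ := Finset.card_eq_one.1 ht₁
    have hx : F {x} = c := hs (by simp)
    have hy : F {y} = c := ht (by simp)
    rw [hx, hy]
  | succ r ih =>
    have hle := le_iterExp lam r
    obtain ⟨b, G, hb, hG⟩ := exists_endHomogeneous F
      (hA ▸ mk_sigma_finset_Iio_lt (hlam.trans hle) (hC.trans_le hle))
    obtain ⟨X, hX, hGX⟩ := ih (mk_ord_toType _) G
    have split (s : Finset A) (hs : ↑s ⊆ b '' X) (hcard : s.card = r + 1 + 1) :
        ∃ u : Finset _, ↑u ⊆ X ∧ u.card = r + 1 ∧ F s = G u := by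
      obtain ⟨v, hv, rfl⟩ := Finset.subset_set_image_iff.1 hs
      rw [Finset.card_image_of_injective _ hb] at hcard
      have hne : v.Nonempty := Finset.card_pos.1 (by omega)
      refine ⟨v.erase (v.max' hne), ?_, ?_, ?_⟩
      · exact (Finset.coe_subset.2 (Finset.erase_subset _ _)).trans hv
      · rw [Finset.card_erase_of_mem (v.max'_mem hne), hcard, Nat.add_sub_cancel]
      · rw [← hG (v.max' hne) _ fun j hj => v.lt_max'_of_mem_erase_max' hne hj,
          Finset.insert_erase (v.max'_mem hne)]
    refine ⟨b '' X, (mk_image_eq hb).trans hX, fun s t hs ht hs₁ ht₁ => ?_⟩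
    obtain ⟨u, hu, hu₁, hsu⟩ := split s hs hs₁
    obtain ⟨v, hv, hv₁, htv⟩ := split t ht ht₁
    rw [hsu, htv, hGX u v hu hv hu₁ hv₁]
end

section
/- (Polarized Erdős–Rado) If λ is an infinite cardinal, r < ω, and F : ((2^λ_r)^+)^{r+1} → λ, then there are sets X_0, X_1, …, X_r ⊆ (2^λ_r)^+, each of cardinality λ, such that F is constant on X_0 × X_1 × ⋯ × X_r. -/
open Cardinal

universe u

theorem exists_lt_mk_fiber {A B : Type u} {c : Cardinal.{u}} (f : A → B) (h : #B * c < #A) :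
    ∃ b, c < #(f ⁻¹' {b}) := by
  by_contra! hf
  exact h.not_ge (mk_le_mk_mul_of_mk_preimage_le f hf)

/-- The type of `a` over the indexed family `s`: how `F` behaves when `a` is appended to tuples
taken from the family. -/
def typeOver {A C L : Type u} {n : ℕ} (F : (Fin (n + 1) → A) → C) (s : Fin n → L → A) (a : A) :
    (Fin n → L) → C :=
  fun k => F (Fin.snoc (fun i => s i (k i)) a)

/-- If `Y` is at most `2 ^ μ` in size and `A` is larger, some `a : A` has at least `lam` many
realizations of its type over every `lam`-indexed family of points of `Y`. -/
theorem exists_forall_le_mk_typeOver_eq {A C L : Type u} {lam μ : Cardinal.{u}}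
    (hlam : ℵ₀ ≤ lam) (hμ : lam ≤ μ) (hL : #L = lam) (hC : #C ≤ lam) (hA : 2 ^ μ < #A)
    {n : ℕ} (F : (Fin (n + 1) → A) → C) (Y : Set A) (hY : #Y ≤ 2 ^ μ) :
    ∃ a, ∀ s : Fin n → L → Y,
      lam ≤ #{b | typeOver F (fun i l => (s i l : A)) b = typeOver F (fun i l => (s i l : A)) a} := by
  by_contra! h
  choose s hs using h
  have hμ₀ : ℵ₀ ≤ μ := hlam.trans hμ
  have hlam' : lam ≤ 2 ^ μ := hμ.trans (cantor μ).le
  have h2μ : ℵ₀ ≤ (2 : Cardinal.{u}) ^ μ := hlam.trans hlam'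
  have hpow {x y : Cardinal.{u}} (hx : x ≤ 2 ^ μ) (hy : y ≤ μ) : x ^ y ≤ 2 ^ μ := by
    calc x ^ y ≤ (2 ^ μ) ^ y := power_le_power_right hx
      _ = 2 ^ (μ * y) := (power_mul ..).symm
      _ ≤ 2 ^ μ := power_le_power_left two_ne_zero
          ((mul_le_mul_right hy μ).trans (mul_eq_self hμ₀).le)
  have hfam : #(Fin n → L → Y) ≤ 2 ^ μ := by
    have : #(L → Y) ≤ 2 ^ μ := by
      simpa using hpow hY (hL.le.trans hμ)
    simpa using hpow this ((natCast_lt_aleph0 (n := n)).le.trans hμ₀)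
  have htup : #(Fin n → L) ≤ μ := by
    simpa [hL] using (power_nat_le hlam).trans hμ
  have htype : #((Fin n → L) → C) ≤ 2 ^ μ := by
    simpa using hpow (hC.trans hlam') htup
  obtain ⟨⟨t, p⟩, hb⟩ := exists_lt_mk_fiber (c := lam)
    (fun a => (s a, typeOver F (fun i l => (s a i l : A)) a)) (lt_of_le_of_lt (by
      rw [mk_prod, lift_id, lift_id]
      exact mul_le_of_le h2μ (mul_le_of_le h2μ hfam htype) hlam') hA)
  obtain ⟨⟨a, ha⟩⟩ := mk_ne_zero_iff.mp (ne_bot_of_gt hb)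
  obtain ⟨rfl, rfl⟩ := Prod.mk.inj ha
  refine (hb.trans_le (mk_le_mk_of_subset ?_)).not_gt (hs a)
  intro b hb
  obtain ⟨h₁, h₂⟩ := Prod.mk.inj hb
  rw [h₁] at h₂
  exact h₂

theorem exists_injective_families_const {C L : Type u} {lam : Cardinal.{u}} (hlam : ℵ₀ ≤ lam)
    (hL : #L = lam) (hC : #C ≤ lam) (r : ℕ) {A : Type u} (hA : iterExp lam r < #A)
    (F : (Fin (r + 1) → A) → C) :
    ∃ s : Fin (r + 1) → L → A, (∀ i, Function.Injective (s i)) ∧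
      ∃ c, ∀ k : Fin (r + 1) → L, F (fun i => s i (k i)) = c := by
  induction r generalizing A with
  | zero =>
    obtain ⟨c, hc⟩ := exists_lt_mk_fiber (c := lam) (fun a => F (fun _ => a))
      (lt_of_le_of_lt (mul_le_of_le hlam hC le_rfl) hA)
    obtain ⟨e⟩ := hL.trans_le hc.le
    refine ⟨fun _ l => e l, fun _ => Subtype.val_injective.comp e.injective, c, fun k => ?_⟩
    have : (fun i => (e (k i) : A)) = fun _ => (e (k 0) : A) := by
      funext i; rw [Fin.fin_one_eq_zero i]
    rw [this]
    exact (e (k 0)).2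
  | succ r ih =>
    obtain ⟨Y, hY⟩ := le_mk_iff_exists_set.mp hA.le
    obtain ⟨a, ha⟩ := exists_forall_le_mk_typeOver_eq hlam (le_iterExp lam r) hL hC hA F Y hY.le
    obtain ⟨s, hs, c, hc⟩ := ih (A := Y) (hY ▸ cantor _)
      (fun y => F (Fin.snoc (fun i => (y i : A)) a))
    obtain ⟨e⟩ := hL.trans_le (ha s)
    refine ⟨Fin.snoc (fun i l => (s i l : A)) (fun l => (e l : A)), fun i => ?_, c, fun k => ?_⟩
    · induction i using Fin.lastCases with
      | last =>
        rw [Fin.snoc_last]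
        exact Subtype.val_injective.comp e.injective
      | cast i =>
        rw [Fin.snoc_castSucc]
        exact Subtype.val_injective.comp (hs i)
    · rw [← hc (fun i => k i.castSucc)]
      refine Eq.trans (congrArg F ?_)
        (congrFun (e (k (Fin.last (r + 1)))).2 (fun i => k i.castSucc))
      funext i
      induction i using Fin.lastCases <;> simp

/-- The polarized Erdős–Rado theorem: if `A` has cardinality `(2^λ_r)⁺` and
`F : A^{r+1} → C` with `|C| = λ`, then there are `X₀,…,X_r ⊆ A`, each of cardinality
`λ`, such that `F` is constant on `X₀ × ⋯ × X_r`. -/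
theorem polarized_erdos_rado {A C : Type u} (lam : Cardinal.{u}) (hlam : aleph0 ≤ lam)
    (r : ℕ) (hA : #A = Order.succ (iterExp lam r)) (hC : #C = lam)
    (F : (Fin (r + 1) → A) → C) :
    ∃ X : Fin (r + 1) → Set A, (∀ i, #(X i) = lam) ∧
      ∀ x y : Fin (r + 1) → A, (∀ i, x i ∈ X i) → (∀ i, y i ∈ X i) → F x = F y := by
  obtain ⟨s, hs, c, hc⟩ := exists_injective_families_const hlam (mk_out lam) hC.le r
    (hA ▸ Order.lt_succ _) F
  have hconst (x : Fin (r + 1) → A) (hx : ∀ i, x i ∈ Set.range (s i)) : F x = c := by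
    choose k hk using hx
    rw [← funext hk]
    exact hc k
  exact ⟨fun i => Set.range (s i), fun i => (mk_range_eq _ (hs i)).trans (mk_out lam),
    fun x y hx hy => (hconst x hx).trans (hconst y hy).symm⟩
end

section
/- Let f : U → ℝ be a Nash function, where U ⊆ ℝ^n is open and connected. Suppose D ⊆ ℝ, the graph of f is definable in the ordered field ℝ with parameters from D, and there is t = (t_0,…,t_{n-1}) ∈ U such that f(t_0,…,t_{n-1}) = 0 and t_0,…,t_{n-1} are algebraically independent over the subfield of ℝ generated by D. Then f is identically 0 on U. -/
/-- Terms of the first-order language of ordered fields `{+,-,×,0,1,≤}`,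
with variables indexed by `ℕ`. -/
inductive OFTerm : Type
  | var : ℕ → OFTerm
  | zero : OFTerm
  | one : OFTerm
  | add : OFTerm → OFTerm → OFTerm
  | mul : OFTerm → OFTerm → OFTerm
  | neg : OFTerm → OFTerm

/-- First-order formulas of the language of ordered fields (with equality;
`≠`, `∨`, `→`, `∀`, `<` etc. are expressible from `=`, `≤`, `¬`, `∧`, `∃`). -/
inductive OFFml : Type
  | eq : OFTerm → OFTerm → OFFml
  | le : OFTerm → OFTerm → OFFml
  | not : OFFml → OFFml
  | and : OFFml → OFFml → OFFml
  | ex : ℕ → OFFml → OFFml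

def OFTerm.eval (v : ℕ → ℝ) : OFTerm → ℝ
  | var i => v i
  | zero => 0
  | one => 1
  | add s t => s.eval v + t.eval v
  | mul s t => s.eval v * t.eval v
  | neg t => - t.eval v

/-- Realization (satisfaction) of a formula in the ordered field `ℝ`
under the valuation `v`. -/
def OFFml.Realize (v : ℕ → ℝ) : OFFml → Prop
  | eq s t => s.eval v = t.eval v
  | le s t => s.eval v ≤ t.eval v
  | not φ => ¬ φ.Realize v
  | and φ ψ => φ.Realize v ∧ ψ.Realize v
  | ex i φ => ∃ r : ℝ, φ.Realize (Function.update v i r)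

def OFTerm.fv : OFTerm → Finset ℕ
  | var i => {i}
  | zero => ∅
  | one => ∅
  | add s t => s.fv ∪ t.fv
  | mul s t => s.fv ∪ t.fv
  | neg t => t.fv

/-- The free variables of a formula. -/
def OFFml.fv : OFFml → Finset ℕ
  | eq s t => s.fv ∪ t.fv
  | le s t => s.fv ∪ t.fv
  | not φ => φ.fv
  | and φ ψ => φ.fv ∪ ψ.fv
  | ex i φ => φ.fv.erase i

/-- The graph of `f` restricted to `U` is definable in the ordered field `ℝ` with
parameters from `D`: variables `0,…,n-1` stand for the input, variable `n` for the
output, and all remaining variables take values that are parameters from `D` (the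
constants `0`, `1` of the language are always available). -/
def DefinableGraphWithParams (n : ℕ) (D : Set ℝ) (U : Set (Fin n → ℝ))
    (f : (Fin n → ℝ) → ℝ) : Prop :=
  ∃ (θ : OFFml) (params : ℕ → ℝ), (∀ i, params i ∈ D ∨ params i = 0) ∧
    ∀ (x : Fin n → ℝ) (y : ℝ),
      (x ∈ U ∧ f x = y) ↔ θ.Realize (fun i =>
        if h : i < n then x ⟨i, h⟩ else if i = n then y else params i)

section NashVanishing

open Polynomial Filter Topology

/-- Any point of an open interval can be moved to any other one by an order automorphism of `ℝ`
which is the identity off the interval. -/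
theorem exists_orderIso_moving {a b u v : ℝ} (hau : a < u) (hub : u < b) (hav : a < v)
    (hvb : v < b) : ∃ k : ℝ ≃o ℝ, k u = v ∧ ∀ x, x ∉ Set.Ioo a b → k x = x := by
  let F : ℝ → ℝ → ℝ → ℝ := fun u v x =>
    if x ≤ a then x else if x ≤ u then a + (v - a) / (u - a) * (x - a)
      else if x ≤ b then b - (b - v) / (b - u) * (b - x) else x
  have hmono : ∀ u v : ℝ, a < u → u < b → a < v → v < b → StrictMono (F u v) := by
    intro u v hau hub hav hvb
    have hα : 0 < (v - a) / (u - a) := div_pos (by linarith) (by linarith)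
    have hβ : 0 < (b - v) / (b - u) := div_pos (by linarith) (by linarith)
    have eα : (v - a) / (u - a) * (u - a) = v - a := div_mul_cancel₀ _ (by linarith)
    have eβ : (b - v) / (b - u) * (b - u) = b - v := div_mul_cancel₀ _ (by linarith)
    intro x y hxy
    simp only [F]
    generalize (v - a) / (u - a) = α at *
    generalize (b - v) / (b - u) = β at *
    split_ifs <;> nlinarith
  have hinv : ∀ u v : ℝ, a < u → u < b → a < v → v < b → ∀ x, F u v (F v u x) = x := by
    intro u v hau hub hav hvb x
    have hα : 0 < (u - a) / (v - a) := div_pos (by linarith) (by linarith)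
    have hβ : 0 < (b - u) / (b - v) := div_pos (by linarith) (by linarith)
    have eα : (u - a) / (v - a) * (v - a) = u - a := div_mul_cancel₀ _ (by linarith)
    have eβ : (b - u) / (b - v) * (b - v) = b - u := div_mul_cancel₀ _ (by linarith)
    have eα' : (v - a) / (u - a) * ((u - a) / (v - a)) = 1 := by
      have : u - a ≠ 0 := by linarith
      have : v - a ≠ 0 := by linarith
      field_simp
    have eβ' : (b - v) / (b - u) * ((b - u) / (b - v)) = 1 := by
      have : b - u ≠ 0 := by linarith
      have : b - v ≠ 0 := by linarith
      field_simp
    simp only [F]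
    generalize (u - a) / (v - a) = α at *
    generalize (b - u) / (b - v) = β at *
    generalize (v - a) / (u - a) = α' at *
    generalize (b - v) / (b - u) = β' at *
    by_cases h1 : x ≤ a
    · simp [h1]
    by_cases h2 : x ≤ v
    · rw [if_neg h1, if_pos h2, if_neg (by nlinarith), if_pos (by nlinarith)]
      linear_combination (x - a) * eα'
    by_cases h3 : x ≤ b
    · rw [if_neg h1, if_neg h2, if_pos h3, if_neg (by nlinarith), if_neg (by nlinarith),
        if_pos (by nlinarith)]
      linear_combination (x - b) * eβ'
    · rw [if_neg h1, if_neg h2, if_neg h3, if_neg h1, if_neg (by linarith), if_neg h3]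
  refine ⟨(hmono u v hau hub hav hvb).orderIsoOfRightInverse _ (F v u)
    (hinv u v hau hub hav hvb), ?_, ?_⟩
  · have : (v - a) / (u - a) * (u - a) = v - a := div_mul_cancel₀ _ (by linarith)
    simp [F, not_le.2 hau, this]
  · intro x hx
    have : x ≤ a ∨ b ≤ x := by
      by_contra! h
      exact hx h
    rcases this with h | h
    · simp [F, h]
    · rcases h.eq_or_lt with rfl | h
      · simp [F, not_le.2 hub, not_le.2 (hau.trans hub)]
      · simp [F, not_le.2 h, not_le.2 (hub.trans h), not_le.2 ((hau.trans hub).trans h)]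

/-- A real polynomial has constant sign on an interval without roots. -/
theorem sign_eval_eq_of_forall_ne_zero (P : ℝ[X]) {x y : ℝ}
    (h : ∀ z ∈ Set.uIcc x y, P.eval z ≠ 0) :
    SignType.sign (P.eval x) = SignType.sign (P.eval y) := by
  have hiv := intermediate_value_uIcc (f := fun z => P.eval z) (a := x) (b := y)
    P.continuous.continuousOn
  have h0 : (0 : ℝ) ∉ Set.uIcc (P.eval x) (P.eval y) := by
    intro h0
    obtain ⟨z, hz, hz0⟩ := hiv h0
    exact h z hz hz0
  rw [Set.mem_uIcc, not_or, not_and_or, not_and_or, not_le, not_le, not_le, not_le] at h0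
  rcases lt_trichotomy (P.eval x) 0 with hx | hx | hx
  · have hy : P.eval y < 0 := by
      rcases h0 with ⟨h1 | h1, h2 | h2⟩ <;> linarith
    rw [sign_neg hx, sign_neg hy]
  · exact absurd hx (h x Set.left_mem_uIcc)
  · have hy : 0 < P.eval y := by
      rcases h0 with ⟨h1 | h1, h2 | h2⟩ <;> linarith
    rw [sign_pos hx, sign_pos hy]

theorem strictMonoOn_or_strictAntiOn_of_derivative_ne_zero (P : ℝ[X]) {a b : ℝ} (hab : a < b)
    (h : ∀ x ∈ Set.Ioo a b, P.derivative.eval x ≠ 0) :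
    StrictMonoOn (fun x => P.eval x) (Set.Icc a b) ∨
      StrictAntiOn (fun x => P.eval x) (Set.Icc a b) := by
  refine ContinuousOn.strictMonoOn_of_injOn_Icc' hab.le P.continuous.continuousOn ?_
  have key : ∀ x ∈ Set.Icc a b, ∀ y ∈ Set.Icc a b, x < y → P.eval x ≠ P.eval y := by
    intro x hx y hy hxy he
    obtain ⟨c, hc, hc0⟩ := exists_deriv_eq_zero (f := fun x => P.eval x) hxy
      P.continuous.continuousOn he
    rw [Polynomial.deriv] at hc0
    exact h c ⟨hx.1.trans_lt hc.1, hc.2.trans_le hy.2⟩ hc0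
  intro x hx y hy he
  rcases lt_trichotomy x y with hl | hl | hl
  · exact absurd he (key x hx y hy hl)
  · exact hl
  · exact absurd he.symm (key y hy x hx hl)

/-- On an interval where the derivative has no zero, a polynomial has a zero if and only if
it takes values of opposite sign at the end points. -/
theorem exists_root_Ioo_iff (P : ℝ[X]) {a b : ℝ} (hab : a < b)
    (h : ∀ x ∈ Set.Ioo a b, P.derivative.eval x ≠ 0) :
    (∃ x ∈ Set.Ioo a b, P.eval x = 0) ↔
      SignType.sign (P.eval a) * SignType.sign (P.eval b) = -1 := by
  rw [← sign_mul, sign_eq_neg_one_iff]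
  constructor
  · rintro ⟨x, hx, hx0⟩
    rcases strictMonoOn_or_strictAntiOn_of_derivative_ne_zero P hab h with hm | hm
    · have h1 := hm ⟨le_rfl, hab.le⟩ ⟨hx.1.le, hx.2.le⟩ hx.1
      have h2 := hm ⟨hx.1.le, hx.2.le⟩ ⟨hab.le, le_rfl⟩ hx.2
      simp only [hx0] at h1 h2
      exact mul_neg_of_neg_of_pos h1 h2
    · have h1 := hm ⟨le_rfl, hab.le⟩ ⟨hx.1.le, hx.2.le⟩ hx.1
      have h2 := hm ⟨hx.1.le, hx.2.le⟩ ⟨hab.le, le_rfl⟩ hx.2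
      simp only [hx0] at h1 h2
      exact mul_neg_of_pos_of_neg h1 h2
  · intro hneg
    by_contra! hno
    have hs : SignType.sign (P.eval a) = SignType.sign (P.eval b) := by
      refine sign_eval_eq_of_forall_ne_zero P fun z hz => ?_
      rw [Set.uIcc_of_le hab.le] at hz
      intro hz0
      rcases hz.1.eq_or_lt with rfl | h1
      · simp [hz0] at hneg
      rcases hz.2.eq_or_lt with rfl | h2
      · simp [hz0] at hneg
      exact hno z ⟨h1, h2⟩ hz0
    have := sign_neg hneg
    rw [sign_mul, hs] at this
    revert this
    generalize SignType.sign (P.eval b) = s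
    revert s
    decide

theorem root_unique_of_derivative_ne_zero (P : ℝ[X]) {a b : ℝ} (hab : a < b)
    (h : ∀ x ∈ Set.Ioo a b, P.derivative.eval x ≠ 0) {x y : ℝ} (hx : x ∈ Set.Icc a b)
    (hy : y ∈ Set.Icc a b) (hx0 : P.eval x = 0) (hy0 : P.eval y = 0) : x = y := by
  rcases strictMonoOn_or_strictAntiOn_of_derivative_ne_zero P hab h with hm | hm <;>
    exact hm.injOn hx hy (hx0.trans hy0.symm)

theorem eventually_sign_eval_eq_sign_leadingCoeff (P : ℝ[X]) :
    ∀ᶠ x in atTop, SignType.sign (P.eval x) = SignType.sign P.leadingCoeff := by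
  obtain ⟨φ, hφ, he⟩ := P.isEquivalent_atTop_lead.exists_eq_mul
  filter_upwards [he, hφ.eventually (lt_mem_nhds one_pos), eventually_gt_atTop 0] with x h1 h2 h3
  rw [h1, Pi.mul_apply, sign_mul, sign_mul, sign_pos h2, sign_pos (pow_pos h3 _), one_mul, mul_one]

theorem eventually_sign_eval_atBot (P : ℝ[X]) :
    ∀ᶠ x in atBot, SignType.sign (P.eval x) =
      SignType.sign (P.leadingCoeff * (-1) ^ P.natDegree) := by
  have h := eventually_sign_eval_eq_sign_leadingCoeff (P.comp (-X))
  have h2 := tendsto_neg_atBot_atTop.eventually h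
  filter_upwards [h2] with x hx
  rw [leadingCoeff_comp (by simp)] at hx
  simpa using hx

/-- Two finite families of real polynomials with the same sign diagram, one containing the
derivative of `P` and the other the derivative of `P'`, keep matching sign diagrams when `P` and
`P'` are added, provided the signs of `P` and `P'` agree at the roots of the family and at
infinity. -/
theorem exists_orderIso_sign_eval_eq {ι : Type*} (s : Finset ι) (Q Q' : ι → ℝ[X]) (h : ℝ ≃o ℝ)
    (hQ : ∀ i ∈ s, ∀ x, SignType.sign ((Q i).eval x) = SignType.sign ((Q' i).eval (h x)))
    (P P' : ℝ[X]) (hdeg : P.natDegree = P'.natDegree) (hpos : 0 < P.natDegree)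
    (hlc : SignType.sign P.leadingCoeff = SignType.sign P'.leadingCoeff)
    {j : ι} (hj : j ∈ s) (hQj : Q j = derivative P) (hQj' : Q' j = derivative P')
    (hroot : ∀ i ∈ s, Q i ≠ 0 → ∀ x, (Q i).eval x = 0 →
      SignType.sign (P.eval x) = SignType.sign (P'.eval (h x))) :
    ∃ g : ℝ ≃o ℝ,
      (∀ i ∈ s, ∀ x, SignType.sign ((Q i).eval x) = SignType.sign ((Q' i).eval (g x))) ∧
      ∀ x, SignType.sign (P.eval x) = SignType.sign (P'.eval (g x)) := by
  classical
  have hP : P.leadingCoeff ≠ 0 := by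
    rw [leadingCoeff_ne_zero]
    rintro rfl
    simp at hpos
  have hdP : derivative P ≠ 0 := by
    intro h0
    rw [derivative_eq_zero.1 h0] at hpos
    exact lt_irrefl _ hpos
  have hlcB : SignType.sign (P.leadingCoeff * (-1) ^ P.natDegree) =
      SignType.sign (P'.leadingCoeff * (-1) ^ P'.natDegree) := by
    rw [sign_mul, sign_mul, hlc, hdeg]
  obtain ⟨M, hM⟩ := eventually_atTop.1 ((eventually_sign_eval_eq_sign_leadingCoeff P).and
    (h.tendsto_atTop.eventually (eventually_sign_eval_eq_sign_leadingCoeff P')))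
  obtain ⟨m₀, hm₀⟩ := eventually_atBot.1 ((eventually_sign_eval_atBot P).and
    (h.tendsto_atBot.eventually (eventually_sign_eval_atBot P')))
  obtain ⟨m, hmM, hm⟩ : ∃ m < M, ∀ x ≤ m,
      SignType.sign (P.eval x) = SignType.sign (P.leadingCoeff * (-1) ^ P.natDegree) ∧
      SignType.sign (P'.eval (h x)) = SignType.sign (P'.leadingCoeff * (-1) ^ P'.natDegree) :=
    ⟨min m₀ (M - 1), by linarith [min_le_right m₀ (M - 1)],
      fun x hx => hm₀ x (hx.trans (min_le_left _ _))⟩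
  have htop : ∀ x, M ≤ x → P.eval x ≠ 0 ∧ P'.eval (h x) ≠ 0 := by
    intro x hx
    constructor <;> rw [← sign_ne_zero]
    · rw [(hM x hx).1, sign_ne_zero]; exact hP
    · rw [(hM x hx).2, ← hlc, sign_ne_zero]; exact hP
  have hbot : ∀ x, x ≤ m → P.eval x ≠ 0 ∧ P'.eval (h x) ≠ 0 := by
    intro x hx
    have : P.leadingCoeff * (-1) ^ P.natDegree ≠ 0 := mul_ne_zero hP (by simp)
    constructor <;> rw [← sign_ne_zero]
    · rw [(hm x hx).1, sign_ne_zero]; exact this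
    · rw [(hm x hx).2, ← hlcB, sign_ne_zero]; exact this
  let E : Finset ℝ := insert m (insert M (s.biUnion fun i => (Q i).roots.toFinset))
  have hmE : m ∈ E := Finset.mem_insert_self _ _
  have hME : M ∈ E := Finset.mem_insert_of_mem (Finset.mem_insert_self _ _)
  have hrE : ∀ i ∈ s, Q i ≠ 0 → ∀ x, (Q i).eval x = 0 → x ∈ E := by
    intro i hi h0 x hx
    refine Finset.mem_insert_of_mem (Finset.mem_insert_of_mem (Finset.mem_biUnion.2 ⟨i, hi, ?_⟩))
    simpa [h0] using hx
  have hE : ∀ e ∈ E, SignType.sign (P.eval e) = SignType.sign (P'.eval (h e)) := by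
    intro e he
    simp only [E, Finset.mem_insert, Finset.mem_biUnion, Multiset.mem_toFinset, mem_roots'] at he
    rcases he with rfl | rfl | ⟨i, hi, h0, hx⟩
    · rw [(hm e le_rfl).1, (hm e le_rfl).2, hlcB]
    · rw [(hM e le_rfl).1, (hM e le_rfl).2, hlc]
    · exact hroot i hi h0 e hx
  have hder : ∀ z, z ∉ E → P.derivative.eval z ≠ 0 ∧ P'.derivative.eval (h z) ≠ 0 := by
    intro z hz
    have h1 : P.derivative.eval z ≠ 0 := by
      rw [← hQj] at hdP ⊢
      exact fun h0 => hz (hrE j hj hdP z h0)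
    refine ⟨h1, ?_⟩
    rw [← hQj', ← sign_ne_zero, ← hQ j hj, sign_ne_zero, hQj]
    exact h1
  have hcell : ∀ x, x ∉ E → m < x → x < M → ∃ a ∈ E, ∃ b ∈ E, a < x ∧ x < b ∧
      ∀ z ∈ Set.Ioo a b, z ∉ E := by
    intro x hx hmx hxM
    have hA : (E.filter (· < x)).Nonempty := ⟨m, by simp [hmE, hmx]⟩
    have hB : (E.filter (x < ·)).Nonempty := ⟨M, by simp [hME, hxM]⟩
    have ha := Finset.mem_filter.1 (Finset.max'_mem _ hA)
    have hb := Finset.mem_filter.1 (Finset.min'_mem _ hB)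
    refine ⟨_, ha.1, _, hb.1, ha.2, hb.2, fun z hz hzE => ?_⟩
    rcases lt_trichotomy z x with hl | rfl | hl
    · exact (Finset.le_max' (E.filter (· < x)) z (by simp [hzE, hl])).not_gt hz.1
    · exact hx hzE
    · exact (Finset.min'_le (E.filter (x < ·)) z (by simp [hzE, hl])).not_gt hz.2
  have hder' : ∀ g : ℝ ≃o ℝ, (∀ e ∈ E, g e = h e) → ∀ a ∈ E, ∀ b ∈ E,
      (∀ z ∈ Set.Ioo a b, z ∉ E) → ∀ z ∈ Set.Ioo (g a) (g b), P'.derivative.eval z ≠ 0 := by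
    intro g hg a ha b hb hab z hz
    rw [hg a ha, hg b hb] at hz
    have := (hder (h.symm z) (hab _ ⟨h.lt_symm_apply.2 hz.1, h.symm_apply_lt.2 hz.2⟩)).2
    rwa [h.apply_symm_apply] at this
  have hiff : ∀ g : ℝ ≃o ℝ, (∀ e ∈ E, g e = h e) → ∀ a ∈ E, ∀ b ∈ E, a < b →
      (∀ z ∈ Set.Ioo a b, z ∉ E) →
      ((∃ x ∈ Set.Ioo a b, P.eval x = 0) ↔ ∃ x ∈ Set.Ioo (g a) (g b), P'.eval x = 0) := by
    intro g hg a ha b hb hab hno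
    rw [exists_root_Ioo_iff P hab fun z hz => (hder z (hno z hz)).1,
      exists_root_Ioo_iff P' (g.lt_iff_lt.2 hab) (hder' g hg a ha b hb hno), hE a ha, hE b hb,
      hg a ha, hg b hb]
  have hstep : ∀ R : Finset ℝ, (∀ r ∈ R, P.eval r = 0) →
      ∃ g : ℝ ≃o ℝ, (∀ e ∈ E, g e = h e) ∧ ∀ r ∈ R, P'.eval (g r) = 0 := by
    intro R
    induction R using Finset.induction_on with
    | empty => exact fun _ => ⟨h, fun _ _ => rfl, by simp⟩
    | insert r R hr ih =>
      intro hR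
      have hr0 := hR r (Finset.mem_insert_self _ _)
      obtain ⟨g, hg, hgR⟩ := ih fun x hx => hR x (Finset.mem_insert_of_mem hx)
      by_cases hrE' : r ∈ E
      · refine ⟨g, hg, fun x hx => ?_⟩
        rcases Finset.mem_insert.1 hx with rfl | hx
        · have := hE x hrE'
          rw [hr0, sign_zero, eq_comm, sign_eq_zero_iff] at this
          rw [hg x hrE', this]
        · exact hgR x hx
      · have hrm : m < r := not_le.1 fun hle => (hbot r hle).1 hr0
        have hrM : r < M := not_le.1 fun hle => (htop r hle).1 hr0
        obtain ⟨a, ha, b, hb, har, hrb, hno⟩ := hcell r hrE' hrm hrM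
        obtain ⟨v, hv, hv0⟩ := (hiff g hg a ha b hb (har.trans hrb) hno).1 ⟨r, ⟨har, hrb⟩, hr0⟩
        obtain ⟨k, hk, hkfix⟩ := exists_orderIso_moving (g.lt_iff_lt.2 har) (g.lt_iff_lt.2 hrb)
          hv.1 hv.2
        have hfix : ∀ x, x ∉ Set.Ioo a b → k (g x) = g x := by
          intro x hx
          refine hkfix _ fun hgx => hx ⟨g.lt_iff_lt.1 hgx.1, g.lt_iff_lt.1 hgx.2⟩
        refine ⟨g.trans k, fun e he => ?_, fun x hx => ?_⟩
        · rw [OrderIso.trans_apply, hfix e fun hz => hno e hz he, hg e he]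
        · rw [OrderIso.trans_apply]
          rcases Finset.mem_insert.1 hx with rfl | hxR
          · rw [hk, hv0]
          · rw [hfix x, hgR x hxR]
            intro hxab
            have := root_unique_of_derivative_ne_zero P (har.trans hrb)
              (fun z hz => (hder z (hno z hz)).1) ⟨har.le, hrb.le⟩ ⟨hxab.1.le, hxab.2.le⟩ hr0
              (hR x hx)
            exact hr (this ▸ hxR)
  have hP0 : P ≠ 0 := leadingCoeff_ne_zero.1 hP
  obtain ⟨g, hg, hgR⟩ := hstep P.roots.toFinset fun r hr => by simpa [hP0] using hr
  have hroots : ∀ x, P.eval x = 0 ↔ P'.eval (g x) = 0 := by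
    intro x
    constructor
    · intro hx
      exact hgR x (by simpa [hP0] using hx)
    · intro hx
      by_cases hxE : x ∈ E
      · rw [hg x hxE] at hx
        rw [← sign_eq_zero_iff, hE x hxE, hx, sign_zero]
      · obtain ⟨y, hy⟩ := h.surjective (g x)
        have hym : m < y := not_le.1 fun hle => (hbot y hle).2 (hy ▸ hx)
        have hyM : y < M := not_le.1 fun hle => (htop y hle).2 (hy ▸ hx)
        have hxm : m < x := by rwa [← g.lt_iff_lt, hg m hmE, ← hy, h.lt_iff_lt]
        have hxM : x < M := by rwa [← g.lt_iff_lt, hg M hME, ← hy, h.lt_iff_lt]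
        obtain ⟨a, ha, b, hb, hax, hxb, hno⟩ := hcell x hxE hxm hxM
        obtain ⟨r, hr, hr0⟩ := (hiff g hg a ha b hb (hax.trans hxb) hno).2
          ⟨g x, ⟨g.lt_iff_lt.2 hax, g.lt_iff_lt.2 hxb⟩, hx⟩
        have := root_unique_of_derivative_ne_zero P' (g.lt_iff_lt.2 (hax.trans hxb))
          (hder' g hg a ha b hb hno) ⟨g.monotone hax.le, g.monotone hxb.le⟩
          ⟨g.monotone hr.1.le, g.monotone hr.2.le⟩ hx (hgR r (by simpa [hP0] using hr0))
        rwa [g.injective this]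
  have hconst : ∀ x y, (∀ z ∈ Set.uIcc x y, P.eval z ≠ 0) → y ∈ E →
      SignType.sign (P.eval x) = SignType.sign (P'.eval (g x)) := by
    intro x y hxy hy
    rw [sign_eval_eq_of_forall_ne_zero P hxy, hE y hy, ← hg y hy]
    refine (sign_eval_eq_of_forall_ne_zero P' fun z hz hz0 => ?_).symm
    obtain ⟨w, rfl⟩ := g.surjective z
    refine hxy w ?_ ((hroots w).2 hz0)
    rw [Set.mem_uIcc] at hz ⊢
    simpa only [g.le_iff_le] using hz
  refine ⟨g, fun i hi x => ?_, fun x => ?_⟩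
  · by_cases hxE : x ∈ E
    · rw [hQ i hi, hg x hxE]
    rw [hQ i hi]
    by_cases h0 : Q i = 0
    · have hz : ∀ y, (Q' i).eval y = 0 := by
        intro y
        rw [← h.apply_symm_apply y, ← sign_eq_zero_iff, ← hQ i hi, h0, eval_zero, sign_zero]
      rw [hz, hz]
    · refine sign_eval_eq_of_forall_ne_zero _ fun z hz hz0 => ?_
      obtain ⟨w, rfl⟩ := h.surjective z
      have hwE : w ∈ E := by
        refine hrE i hi h0 w ?_
        rw [← sign_eq_zero_iff, hQ i hi, hz0, sign_zero]
      have hne : w ≠ x := fun hwx => hxE (hwx ▸ hwE)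
      rw [Set.mem_uIcc] at hz
      rcases hz with ⟨h1, h2⟩ | ⟨h1, h2⟩
      · rw [← hg w hwE] at h2
        exact hne (le_antisymm (g.le_iff_le.1 h2) (h.le_iff_le.1 h1))
      · rw [← hg w hwE] at h1
        exact hne (le_antisymm (h.le_iff_le.1 h2) (g.le_iff_le.1 h1))
  · by_cases hxE : x ∈ E
    · rw [hE x hxE, hg x hxE]
    by_cases hx0 : P.eval x = 0
    · rw [hx0, (hroots x).1 hx0]
    rcases le_or_gt x m with hxm | hxm
    · refine hconst x m (fun z hz => ?_) hmE
      rw [Set.uIcc_of_le hxm] at hz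
      exact (hbot z hz.2).1
    rcases le_or_gt M x with hxM | hxM
    · refine hconst x M (fun z hz => ?_) hME
      rw [Set.uIcc_of_ge hxM] at hz
      exact (htop z hz.1).1
    obtain ⟨a, ha, b, hb, hax, hxb, hno⟩ := hcell x hxE hxm hxM
    by_cases hxa : ∀ z ∈ Set.uIcc x a, P.eval z ≠ 0
    · exact hconst x a hxa ha
    push Not at hxa
    obtain ⟨z, hz, hz0⟩ := hxa
    rw [Set.uIcc_of_ge hax.le] at hz
    refine hconst x b (fun w hw hw0 => ?_) hb
    rw [Set.uIcc_of_le hxb.le] at hw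
    have hwz := root_unique_of_derivative_ne_zero P (hax.trans hxb)
      (fun z hz => (hder z (hno z hz)).1) ⟨hax.le.trans hw.1, hw.2⟩ ⟨hz.1, hz.2.trans hxb.le⟩
      hw0 hz0
    have : x = z := le_antisymm (hw.1.trans hwz.le) hz.2
    exact hx0 (this ▸ hz0)

section SignDiagram

variable {A : Type*} [CommRing A]

/-- Pseudo-division: at the zeros of `q`, when its degree after specialization is `j`, the sign of
`p` is that of a polynomial of degree less than `j`. -/
theorem exists_degree_lt_sign_eval_eq (q p : A[X]) (j : ℕ) :
    ∃ r : A[X], r.degree < j ∧ ∀ φ : A →+* ℝ, q.map φ ≠ 0 → (q.map φ).natDegree = j →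
      ∀ x, (q.map φ).eval x = 0 →
        SignType.sign ((p.map φ).eval x) = SignType.sign ((r.map φ).eval x) := by
  suffices H : ∀ n : ℕ, ∀ p : A[X], p.degree < (j + n : ℕ) → ∃ r : A[X], r.degree < j ∧
      ∀ φ : A →+* ℝ, q.map φ ≠ 0 → (q.map φ).natDegree = j → ∀ x, (q.map φ).eval x = 0 →
        SignType.sign ((p.map φ).eval x) = SignType.sign ((r.map φ).eval x) by
    refine H (p.natDegree + 1) p ?_
    rw [degree_lt_iff_coeff_zero]
    exact fun m hm => coeff_eq_zero_of_natDegree_lt (by omega)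
  intro n
  induction n with
  | zero => exact fun p hp => ⟨p, by simpa using hp, fun _ _ _ _ _ => rfl⟩
  | succ n ih =>
    intro p hp
    let q₀ : A[X] := ∑ i ∈ Finset.range (j + 1), monomial i (q.coeff i)
    have hq₀ : ∀ m, q₀.coeff m = if m < j + 1 then q.coeff m else 0 := by
      intro m
      simp [q₀, coeff_monomial]
    obtain ⟨r, hr, hrs⟩ := ih (C (q.coeff j ^ 2) * p -
        C (q.coeff j * p.coeff (j + n)) * (X ^ n * q₀)) (by
      rw [degree_lt_iff_coeff_zero] at hp ⊢
      intro m hm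
      rw [coeff_sub, coeff_C_mul, coeff_C_mul, coeff_X_pow_mul', if_pos (by omega), hq₀]
      rcases hm.eq_or_lt with rfl | hm
      · rw [Nat.add_sub_cancel, if_pos (by omega)]
        ring
      · rw [if_neg (by omega), hp m (by omega)]
        ring)
    refine ⟨r, hr, fun φ h0 hdeg x hx => ?_⟩
    have hmap : q₀.map φ = q.map φ := by
      ext m
      rw [coeff_map, hq₀, coeff_map]
      split_ifs with hm
      · rfl
      · rw [map_zero, ← coeff_map, coeff_eq_zero_of_natDegree_lt (by omega)]
    have hc : 0 < φ (q.coeff j) ^ 2 := by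
      rw [← coeff_map, ← hdeg]
      exact sq_pos_of_ne_zero (leadingCoeff_ne_zero.2 h0)
    rw [← hrs φ h0 hdeg x hx]
    simp [hmap, hx, sign_mul, sign_pos hc]

/-- The finite family `L` of polynomials has its sign diagram determined by the signs of finitely
many elements of the coefficient ring. -/
def SignDiagramDetermined (L : Finset A[X]) : Prop :=
  ∃ M : Finset A, ∀ φ ψ : A →+* ℝ,
    (∀ a ∈ M, SignType.sign (φ a) = SignType.sign (ψ a)) →
    ∃ h : ℝ ≃o ℝ, ∀ p ∈ L, ∀ x,
      SignType.sign ((p.map φ).eval x) = SignType.sign ((p.map ψ).eval (h x))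

theorem natDegree_map_eq_of_sign_eq {q : A[X]} {d : ℕ} (hq : q.degree < (d + 1 : ℕ))
    {φ ψ : A →+* ℝ}
    (h : ∀ i ∈ Finset.range (d + 1), SignType.sign (φ (q.coeff i)) = SignType.sign (ψ (q.coeff i))) :
    (q.map φ).natDegree = (q.map ψ).natDegree := by
  rw [degree_lt_iff_coeff_zero] at hq
  have hiff : ∀ m, (q.map φ).coeff m = 0 ↔ (q.map ψ).coeff m = 0 := by
    intro m
    rw [coeff_map, coeff_map]
    rcases lt_or_ge m (d + 1) with hm | hm
    · rw [← sign_eq_zero_iff, h m (Finset.mem_range.2 hm), sign_eq_zero_iff]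
    · simp [hq m hm]
  apply le_antisymm <;> rw [natDegree_le_iff_coeff_eq_zero] <;> intro m hm
  · exact (hiff m).2 (coeff_eq_zero_of_natDegree_lt hm)
  · exact (hiff m).1 (coeff_eq_zero_of_natDegree_lt hm)

theorem signDiagramDetermined_insert [DecidableEq A] {d : ℕ} {L : Finset A[X]} {p : A[X]}
    (hL : ∀ q ∈ L, q.degree < (d + 1 : ℕ)) (hp : p.degree < (d + 1 : ℕ))
    (ih : ∀ S : Finset A[X], (∀ q ∈ S, q.degree < d) → SignDiagramDetermined (S ∪ L)) :
    SignDiagramDetermined (insert p L) := by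
  classical
  choose rem hrem_deg hrem using fun q : A[X] => exists_degree_lt_sign_eval_eq q p
  have hcoeff := (degree_lt_iff_coeff_zero _ _).1 hp
  have hdp : (derivative p).degree < d := by
    rw [degree_lt_iff_coeff_zero]
    intro m hm
    rw [coeff_derivative, hcoeff _ (by omega), zero_mul]
  let L₁ := insert (derivative p) L
  have hL₁ : ∀ q ∈ L₁, q.degree < (d + 1 : ℕ) := by
    intro q hq
    rcases Finset.mem_insert.1 hq with rfl | hq
    · exact hdp.trans (by exact_mod_cast Nat.lt_succ_self d)
    · exact hL q hq
  let S : Finset A[X] := insert (derivative p) (insert (p.erase d)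
    ((L₁ ×ˢ Finset.range (d + 1)).image fun z => rem z.1 z.2))
  obtain ⟨M, hM⟩ := ih S (by
    intro q hq
    simp only [S, Finset.mem_insert, Finset.mem_image, Finset.mem_product, Finset.mem_range] at hq
    rcases hq with rfl | rfl | ⟨z, ⟨-, hz⟩, rfl⟩
    · exact hdp
    · rw [degree_lt_iff_coeff_zero]
      intro m hm
      rw [coeff_erase]
      split_ifs with h
      · rfl
      · exact hcoeff m (by omega)
    · exact (hrem_deg z.1 z.2).trans_le (by exact_mod_cast Nat.lt_succ_iff.1 hz))
  refine ⟨insert (p.coeff d) (M ∪ L₁.biUnion fun q => (Finset.range (d + 1)).image q.coeff),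
    fun φ ψ hφψ => ?_⟩
  obtain ⟨h, hh⟩ := hM φ ψ fun a ha =>
    hφψ a (Finset.mem_insert_of_mem (Finset.mem_union_left _ ha))
  have hc := hφψ _ (Finset.mem_insert_self _ _)
  have hLh : ∀ q ∈ L₁, ∀ x,
      SignType.sign ((q.map φ).eval x) = SignType.sign ((q.map ψ).eval (h x)) := by
    intro q hq
    apply hh
    rcases Finset.mem_insert.1 hq with rfl | hq
    · exact Finset.mem_union_left _ (Finset.mem_insert_self _ _)
    · exact Finset.mem_union_right _ hq
  by_cases hc0 : φ (p.coeff d) = 0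
  · refine ⟨h, fun q hq x => ?_⟩
    rcases Finset.mem_insert.1 hq with rfl | hq
    · have hc0' : ψ (q.coeff d) = 0 := by
        rw [← sign_eq_zero_iff, ← hc, hc0, sign_zero]
      have he : ∀ χ : A →+* ℝ, χ (q.coeff d) = 0 → q.map χ = (q.erase d).map χ := by
        intro χ hχ
        ext m
        rw [coeff_map, coeff_map, coeff_erase]
        split_ifs with hm
        · rw [hm, hχ, map_zero]
        · rfl
      rw [he φ hc0, he ψ hc0']
      exact hh _ (Finset.mem_union_left _
        (Finset.mem_insert_of_mem (Finset.mem_insert_self _ _))) x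
    · exact hLh q (Finset.mem_insert_of_mem hq) x
  have hc0' : ψ (p.coeff d) ≠ 0 := by
    rwa [← sign_ne_zero, ← hc, sign_ne_zero]
  have hdeg : ∀ χ : A →+* ℝ, χ (p.coeff d) ≠ 0 → (p.map χ).natDegree = d := by
    intro χ hχ
    refine natDegree_eq_of_le_of_coeff_ne_zero ?_ (by rwa [coeff_map])
    rw [natDegree_le_iff_coeff_eq_zero]
    intro m hm
    rw [coeff_map, hcoeff m (by omega), map_zero]
  rcases Nat.eq_zero_or_pos d with rfl | hd
  · refine ⟨h, fun q hq x => ?_⟩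
    rcases Finset.mem_insert.1 hq with rfl | hq
    · rw [eq_C_of_natDegree_eq_zero (hdeg φ hc0), eq_C_of_natDegree_eq_zero (hdeg ψ hc0')]
      simpa using hc
    · exact hLh q (Finset.mem_insert_of_mem hq) x
  obtain ⟨g, hg, hgp⟩ := exists_orderIso_sign_eval_eq L₁ (fun q => q.map φ) (fun q => q.map ψ) h
    hLh (p.map φ) (p.map ψ) (by rw [hdeg φ hc0, hdeg ψ hc0']) (by rwa [hdeg φ hc0])
    (by
      rw [leadingCoeff, leadingCoeff, hdeg φ hc0, hdeg ψ hc0', coeff_map, coeff_map]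
      exact hc)
    (Finset.mem_insert_self _ _) (derivative_map p φ).symm (derivative_map p ψ).symm (by
      intro q hq h0 x hx
      have hx' : (q.map ψ).eval (h x) = 0 := by
        rw [← sign_eq_zero_iff, ← hLh q hq, hx, sign_zero]
      have h0' : q.map ψ ≠ 0 := by
        intro h0'
        refine h0 (funext fun y => ?_)
        rw [eval_zero, ← sign_eq_zero_iff, hLh q hq, h0', eval_zero, sign_zero]
      have hnd : (q.map φ).natDegree = (q.map ψ).natDegree :=
        natDegree_map_eq_of_sign_eq (hL₁ q hq) fun i hi => hφψ _ (Finset.mem_insert_of_mem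
          (Finset.mem_union_right _ (Finset.mem_biUnion.2 ⟨q, hq, Finset.mem_image_of_mem _ hi⟩)))
      have hle : (q.map φ).natDegree ∈ Finset.range (d + 1) := by
        rw [Finset.mem_range, Nat.lt_succ_iff, natDegree_le_iff_coeff_eq_zero]
        intro m hm
        rw [coeff_map, (degree_lt_iff_coeff_zero _ _).1 (hL₁ q hq) m (by omega), map_zero]
      rw [hrem q _ φ h0 rfl x hx, hrem q _ ψ h0' hnd.symm (h x) hx']
      exact hh _ (Finset.mem_union_left _ (Finset.mem_insert_of_mem (Finset.mem_insert_of_mem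
        (Finset.mem_image.2 ⟨(q, _), Finset.mem_product.2 ⟨hq, hle⟩, rfl⟩)))) x)
  refine ⟨g, fun q hq x => ?_⟩
  rcases Finset.mem_insert.1 hq with rfl | hq
  · exact hgp x
  · exact hg q (Finset.mem_insert_of_mem hq) x

/-- Tarski's theorem, in semantic form: the sign diagram of a finite family of polynomials depends
only on the signs of finitely many polynomial expressions in the coefficients. -/
theorem signDiagramDetermined (L : Finset A[X]) : SignDiagramDetermined L := by
  classical
  suffices H : ∀ d : ℕ, ∀ L : Finset A[X], (∀ p ∈ L, p.degree < d) → SignDiagramDetermined L by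
    refine H (L.sup natDegree + 1) L fun p hp => ?_
    rw [degree_lt_iff_coeff_zero]
    intro m hm
    have := Finset.le_sup (f := natDegree) hp
    exact coeff_eq_zero_of_natDegree_lt (by omega)
  intro d
  induction d with
  | zero =>
    intro L hL
    refine ⟨∅, fun φ ψ _ => ⟨OrderIso.refl ℝ, fun p hp x => ?_⟩⟩
    have : p = 0 := by simpa using hL p hp
    simp [this]
  | succ d ihd =>
    intro L hL
    suffices H : ∀ S : Finset A[X], (∀ p ∈ S, p.degree < d) → SignDiagramDetermined (S ∪ L) by
      simpa using H ∅ (by simp)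
    induction L using Finset.induction_on with
    | empty => simpa using ihd
    | insert p L _ ih =>
      intro S hS
      rw [Finset.union_insert]
      have hL' : ∀ q ∈ L, q.degree < (d + 1 : ℕ) := fun q hq => hL q (Finset.mem_insert_of_mem hq)
      refine signDiagramDetermined_insert (fun q hq => ?_) (hL p (Finset.mem_insert_self _ _))
        fun S' hS' => ?_
      · rcases Finset.mem_union.1 hq with hq | hq
        · exact (hS q hq).trans (by exact_mod_cast Nat.lt_succ_self d)
        · exact hL' q hq
      · rw [← Finset.union_assoc]
        refine ih hL' _ fun q hq => ?_
        rcases Finset.mem_union.1 hq with hq | hq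
        · exact hS' q hq
        · exact hS q hq

end SignDiagram

/-- Evaluation of integral polynomials at a valuation of the variables. -/
noncomputable def valuationHom (v : ℕ → ℝ) : MvPolynomial ℕ ℤ →+* ℝ :=
  MvPolynomial.eval₂Hom (Int.castRingHom ℝ) v

/-- The polynomial interpreting a term. -/
noncomputable def OFTerm.toMvPolynomial : OFTerm → MvPolynomial ℕ ℤ
  | var i => MvPolynomial.X i
  | zero => 0
  | one => 1
  | add s t => s.toMvPolynomial + t.toMvPolynomial
  | mul s t => s.toMvPolynomial * t.toMvPolynomial
  | neg t => -t.toMvPolynomial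

theorem valuationHom_toMvPolynomial (v : ℕ → ℝ) (t : OFTerm) :
    valuationHom v t.toMvPolynomial = t.eval v := by
  induction t with
  | var i => simp [OFTerm.toMvPolynomial, OFTerm.eval, valuationHom]
  | zero => simp [OFTerm.toMvPolynomial, OFTerm.eval]
  | one => simp [OFTerm.toMvPolynomial, OFTerm.eval]
  | add s t hs ht => simp [OFTerm.toMvPolynomial, OFTerm.eval, hs, ht]
  | mul s t hs ht => simp [OFTerm.toMvPolynomial, OFTerm.eval, hs, ht]
  | neg t ht => simp [OFTerm.toMvPolynomial, OFTerm.eval, ht]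

/-- Regard a polynomial as a univariate polynomial in the variable `i`. -/
noncomputable def separateVariable (i : ℕ) : MvPolynomial ℕ ℤ →+* (MvPolynomial ℕ ℤ)[X] :=
  MvPolynomial.eval₂Hom (Int.castRingHom _)
    fun j => if j = i then X else C (MvPolynomial.X j)

theorem eval_map_separateVariable (i : ℕ) (v : ℕ → ℝ) (x : ℝ) (m : MvPolynomial ℕ ℤ) :
    ((separateVariable i m).map (valuationHom v)).eval x =
      valuationHom (Function.update v i x) m := by
  have : ((evalRingHom x).comp (mapRingHom (valuationHom v))).comp (separateVariable i) =
      valuationHom (Function.update v i x) := by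
    apply MvPolynomial.ringHom_ext
    · intro r
      simp [separateVariable, valuationHom]
    · intro j
      by_cases h : j = i
      · subst h; simp [separateVariable, valuationHom]
      · simp [separateVariable, valuationHom, h]
  exact congrArg (fun f => f m) this

/-- Quantifier elimination, in semantic form: the truth of a formula is determined by the signs of
finitely many integral polynomials. -/
theorem OFFml.exists_finset_realize_iff (θ : OFFml) :
    ∃ M : Finset (MvPolynomial ℕ ℤ), ∀ v w : ℕ → ℝ,
      (∀ m ∈ M, SignType.sign (valuationHom v m) = SignType.sign (valuationHom w m)) →
      (θ.Realize v ↔ θ.Realize w) := by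
  classical
  induction θ with
  | eq s t =>
    refine ⟨{s.toMvPolynomial - t.toMvPolynomial}, fun v w h => ?_⟩
    have := h _ (Finset.mem_singleton_self _)
    simp only [map_sub, valuationHom_toMvPolynomial] at this
    simp only [OFFml.Realize]
    rw [← sub_eq_zero, ← sign_eq_zero_iff, this, sign_eq_zero_iff, sub_eq_zero]
  | le s t =>
    refine ⟨{s.toMvPolynomial - t.toMvPolynomial}, fun v w h => ?_⟩
    have := h _ (Finset.mem_singleton_self _)
    simp only [map_sub, valuationHom_toMvPolynomial] at this
    simp only [OFFml.Realize]
    rw [← not_lt, ← not_lt, ← sub_pos, ← sign_eq_one_iff, this, sign_eq_one_iff, sub_pos]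
  | not φ ih =>
    obtain ⟨M, hM⟩ := ih
    exact ⟨M, fun v w h => not_congr (hM v w h)⟩
  | and φ ψ ih₁ ih₂ =>
    obtain ⟨M₁, h₁⟩ := ih₁
    obtain ⟨M₂, h₂⟩ := ih₂
    exact ⟨M₁ ∪ M₂, fun v w h =>
      and_congr (h₁ v w fun m hm => h m (Finset.mem_union_left _ hm))
        (h₂ v w fun m hm => h m (Finset.mem_union_right _ hm))⟩
  | ex i φ ih =>
    obtain ⟨M, hM⟩ := ih
    obtain ⟨N, hN⟩ := signDiagramDetermined (M.image (separateVariable i))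
    have key : ∀ v w : ℕ → ℝ,
        (∀ m ∈ N, SignType.sign (valuationHom v m) = SignType.sign (valuationHom w m)) →
        (OFFml.ex i φ).Realize v → (OFFml.ex i φ).Realize w := by
      rintro v w h ⟨x, hx⟩
      obtain ⟨g, hg⟩ := hN _ _ h
      refine ⟨g x, (hM _ _ fun m hm => ?_).1 hx⟩
      rw [← eval_map_separateVariable, ← eval_map_separateVariable]
      exact hg _ (Finset.mem_image_of_mem _ hm) x
    exact ⟨N, fun v w h => ⟨key v w h, key w v fun m hm => (h m hm).symm⟩⟩

/-- A smooth function of one variable vanishes to infinite order at the boundary of an open set on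
which it vanishes. -/
theorem isBigO_pow_of_mem_closure_of_eq_zero {I W : Set ℝ} (hI : IsOpen I) (hW : IsOpen W) {p : ℝ}
    (hp : p ∈ I) (hpW : p ∈ closure W) (N : ℕ) {g : ℝ → ℝ}
    (hg : ContDiffOn ℝ (⊤ : ℕ∞) g I) (h0 : ∀ x ∈ W, g x = 0) :
    g =O[𝓝 p] fun x => (x - p) ^ N := by
  induction N generalizing g with
  | zero =>
    simpa using (hg.continuousOn.continuousAt (hI.mem_nhds hp)).tendsto.isBigO_one ℝ
  | succ N ih =>
    have hder := ih (hg.deriv_of_isOpen (m := (⊤ : ℕ∞)) hI (by simp)) fun x hx => by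
      have : g =ᶠ[𝓝 x] fun _ => 0 := by
        filter_upwards [hW.mem_nhds hx] with y hy using h0 y hy
      rw [this.deriv_eq, deriv_const]
    have hgp : g p = 0 := by
      by_contra hne
      have hev := (hg.continuousOn.continuousAt (hI.mem_nhds hp)).eventually_ne hne
      obtain ⟨x, hx, hxW⟩ := mem_closure_iff_nhds.1 hpW _ hev
      exact hx (h0 x hxW)
    obtain ⟨K, hK⟩ := hder.bound
    obtain ⟨ε, hε, hball⟩ := Metric.eventually_nhds_iff_ball.1 (hK.and (hI.mem_nhds hp))
    refine Asymptotics.IsBigO.of_bound K ?_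
    filter_upwards [Metric.ball_mem_nhds p hε] with x hx
    have hsub : ∀ y ∈ Set.uIcc p x, |y - p| ≤ |x - p| := fun y hy =>
      Set.abs_sub_left_of_mem_uIcc hy
    have hin : ∀ y ∈ Set.uIcc p x, y ∈ Metric.ball p ε := fun y hy => by
      rw [Metric.mem_ball, Real.dist_eq] at hx ⊢
      exact (hsub y hy).trans_lt hx
    have hxK := (norm_nonneg _).trans (hball x hx).1
    have hmv := Convex.norm_image_sub_le_of_norm_deriv_le (𝕜 := ℝ) (f := g) (s := Set.uIcc p x)
      (x := p) (y := x) (C := K * ‖(x - p) ^ N‖)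
      (fun y hy => (hg.contDiffAt (hI.mem_nhds (hball y (hin y hy)).2)).differentiableAt (by simp))
      (fun y hy => ?_) (convex_uIcc p x) Set.left_mem_uIcc Set.right_mem_uIcc
    · rw [hgp, sub_zero] at hmv
      rwa [pow_succ, norm_mul, ← mul_assoc]
    · have hy1 := (hball y (hin y hy)).1
      have hle : ‖(y - p) ^ N‖ ≤ ‖(x - p) ^ N‖ := by
        rw [norm_pow, norm_pow, Real.norm_eq_abs, Real.norm_eq_abs]
        exact pow_le_pow_left₀ (abs_nonneg _) (hsub y hy) N
      rcases le_or_gt 0 K with hK0 | hK0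
      · exact hy1.trans (mul_le_mul_of_nonneg_left hle hK0)
      · have hx0 : ‖(x - p) ^ N‖ = 0 := by
          by_contra hne
          exact absurd hxK (not_le.2 (mul_neg_of_neg_of_pos hK0
            (lt_of_le_of_ne (norm_nonneg _) (Ne.symm hne))))
        rw [hx0] at hle ⊢
        rw [le_antisymm hle (norm_nonneg _)] at hy1
        exact hy1

theorem continuous_evalEval (Q : ℝ[X][X]) :
    Continuous fun z : ℝ × ℝ => Q.evalEval z.1 z.2 := by
  induction Q using Polynomial.induction_on' with
  | add P Q hP hQ => simp only [evalEval_add]; exact hP.add hQ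
  | monomial k a =>
    have : (fun z : ℝ × ℝ => (monomial k a).evalEval z.1 z.2) =
        fun z => a.eval z.1 * z.2 ^ k := by
      ext z
      simp [evalEval]
    rw [this]
    exact (a.continuous.comp continuous_fst).mul (continuous_snd.pow k)

/-- A function satisfying a nontrivial polynomial equation and vanishing to infinite order at a
point is zero near this point. -/
theorem eventually_eq_zero_of_evalEval_eq_zero {Q : ℝ[X][X]} (hQ : Q ≠ 0) {g : ℝ → ℝ} {p : ℝ}
    (hgQ : ∀ᶠ x in 𝓝 p, Q.evalEval x (g x) = 0) (hcont : ContinuousAt g p)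
    (hflat : ∀ N : ℕ, g =O[𝓝 p] fun x => (x - p) ^ N) : ∀ᶠ x in 𝓝 p, g x = 0 := by
  obtain ⟨q, hq, hdvd⟩ := exists_eq_pow_rootMultiplicity_mul_and_not_dvd Q hQ 0
  rw [C_0, sub_zero] at hq hdvd
  generalize rootMultiplicity 0 Q = k at hq
  subst hq
  rw [X_dvd_iff] at hdvd
  obtain ⟨a, ha, hadvd⟩ := exists_eq_pow_rootMultiplicity_mul_and_not_dvd _ hdvd p
  generalize rootMultiplicity p (q.coeff 0) = N at ha
  rw [dvd_iff_isRoot, IsRoot.def] at hadvd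
  have hb : (fun x => q.divX.evalEval x (g x)) =O[𝓝 p] fun _ => (1 : ℝ) :=
    (((continuous_evalEval q.divX).continuousAt (x := (p, g p))).comp_of_eq
      (continuousAt_id.prodMk hcont) rfl).tendsto.isBigO_one ℝ
  have ho : (fun x => q.divX.evalEval x (g x) * g x) =o[𝓝 p] fun x => (x - p) ^ N := by
    refine (hb.mul (hflat (N + 1))).trans_isLittleO ?_
    have h1 : (fun x : ℝ => x - p) =o[𝓝 p] fun _ => (1 : ℝ) := by
      rw [Asymptotics.isLittleO_one_iff]
      exact (continuous_sub_right p).tendsto' _ _ (sub_self p)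
    simpa [pow_succ] using (Asymptotics.isBigO_refl (fun x : ℝ => (x - p) ^ N) (𝓝 p)).mul_isLittleO h1
  have hc : 0 < |a.eval p| / 2 := half_pos (abs_pos.2 hadvd)
  have ha_gt : ∀ᶠ x in 𝓝 p, |a.eval p| / 2 < |a.eval x| :=
    (a.continuous.abs.continuousAt (x := p)).eventually (lt_mem_nhds (half_lt_self (abs_pos.2 hadvd)))
  filter_upwards [hgQ, ho.bound hc, ha_gt, (hflat 1).eq_zero_imp] with x hx hbd hax hxp
  by_contra hne
  have hsub : x - p ≠ 0 := fun h => hne (hxp (by rw [h, pow_one]))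
  have hqx : q.evalEval x (g x) = 0 := by
    rw [evalEval_mul, evalEval_pow, evalEval_X] at hx
    exact (mul_eq_zero.1 hx).resolve_left (pow_ne_zero _ hne)
  rw [← divX_mul_X_add q, evalEval_add, evalEval_mul, evalEval_X, evalEval_C, ha] at hqx
  rw [eq_neg_of_add_eq_zero_left hqx, norm_neg] at hbd
  simp only [eval_mul, eval_pow, eval_sub, eval_X, eval_C, norm_mul, Real.norm_eq_abs] at hbd
  have hpos : 0 < |(x - p) ^ N| := abs_pos.2 (pow_ne_zero _ hsub)
  nlinarith

/-- Identity theorem for smooth functions of one variable satisfying a polynomial equation. -/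
theorem eq_zero_on_of_evalEval_eq_zero {Q : ℝ[X][X]} (hQ : Q ≠ 0) {g : ℝ → ℝ} {I : Set ℝ}
    (hI : IsOpen I) (hconn : IsPreconnected I) (hg : ContDiffOn ℝ (⊤ : ℕ∞) g I)
    (hgQ : ∀ x ∈ I, Q.evalEval x (g x) = 0) {x₀ : ℝ} (hx₀ : x₀ ∈ I)
    (hzero : ∀ᶠ x in 𝓝 x₀, g x = 0) : ∀ x ∈ I, g x = 0 := by
  have hW : IsOpen {x | ∀ᶠ y in 𝓝 x, g y = 0} := isOpen_setOfPred_eventually_nhds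
  have hsub := hconn.subset_of_closure_inter_subset hW ⟨x₀, hx₀, hzero⟩ (by
    rintro p ⟨hpW, hpI⟩
    refine eventually_eq_zero_of_evalEval_eq_zero hQ ?_
      (hg.continuousOn.continuousAt (hI.mem_nhds hpI)) fun N => ?_
    · filter_upwards [hI.mem_nhds hpI] with x hx using hgQ x hx
    · exact isBigO_pow_of_mem_closure_of_eq_zero hI hW hpI hpW N hg fun x hx =>
        (show ∀ᶠ y in 𝓝 x, g y = 0 from hx).self_of_nhds)
  exact fun x hx => (show ∀ᶠ y in 𝓝 x, g y = 0 from hsub hx).self_of_nhds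

theorem eventually_sign_eq {α : Type*} [TopologicalSpace α] {F : α → ℝ} {x : α}
    (hF : ContinuousAt F x) (h0 : F x ≠ 0) :
    ∀ᶠ y in 𝓝 x, SignType.sign (F y) = SignType.sign (F x) := by
  rcases h0.lt_or_gt with h | h
  · filter_upwards [hF.eventually (gt_mem_nhds h)] with y hy
    rw [sign_neg hy, sign_neg h]
  · filter_upwards [hF.eventually (lt_mem_nhds h)] with y hy
    rw [sign_pos hy, sign_pos h]

/-- The valuation sending the first `n` variables to `x`, the next one to `y` and the others to
the parameters. -/
def graphValuation {n : ℕ} (params : ℕ → ℝ) (x : Fin n → ℝ) (y : ℝ) (i : ℕ) : ℝ :=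
  if h : i < n then x ⟨i, h⟩ else if i = n then y else params i

theorem exists_mvPolynomial_eval_eq {n : ℕ} (K : Subfield ℝ) {params : ℕ → ℝ}
    (hparams : ∀ i, params i ∈ K) (m : MvPolynomial ℕ ℤ) :
    ∃ q : MvPolynomial (Fin n) ℝ, (∀ e, q.coeff e ∈ K) ∧
      ∀ x, MvPolynomial.eval x q = valuationHom (graphValuation params x 0) m := by
  let σ : MvPolynomial ℕ ℤ →+* MvPolynomial (Fin n) K :=
    MvPolynomial.eval₂Hom (Int.castRingHom _) fun i =>
      if h : i < n then MvPolynomial.X ⟨i, h⟩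
      else if i = n then 0 else MvPolynomial.C ⟨params i, hparams i⟩
  refine ⟨MvPolynomial.map K.subtype (σ m), fun e => ?_, fun x => ?_⟩
  · rw [MvPolynomial.coeff_map]
    exact (MvPolynomial.coeff e (σ m)).2
  · have : ((MvPolynomial.eval x).comp (MvPolynomial.map K.subtype)).comp σ =
        valuationHom (graphValuation params x 0) := by
      apply MvPolynomial.ringHom_ext
      · intro r
        simp
      · intro i
        simp only [σ, valuationHom, graphValuation, RingHom.comp_apply, MvPolynomial.eval₂Hom_X']
        split_ifs <;> simp
    exact congrArg (fun φ => φ m) this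

theorem exists_polynomial_evalEval_eq {n : ℕ} (params : ℕ → ℝ) (v w : Fin n → ℝ)
    (m : MvPolynomial ℕ ℤ) :
    ∃ Q : ℝ[X][X], ∀ s y,
      Q.evalEval s y = valuationHom (graphValuation params (v + s • w) y) m := by
  let σ : MvPolynomial ℕ ℤ →+* ℝ[X][X] :=
    MvPolynomial.eval₂Hom (Int.castRingHom _) fun i =>
      if h : i < n then C (C (v ⟨i, h⟩) + X * C (w ⟨i, h⟩))
      else if i = n then X else C (C (params i))
  refine ⟨σ m, fun s y => ?_⟩
  have : (evalEvalRingHom s y).comp σ = valuationHom (graphValuation params (v + s • w) y) := by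
    apply MvPolynomial.ringHom_ext
    · intro r
      simp
    · intro i
      simp only [σ, valuationHom, graphValuation, RingHom.comp_apply, MvPolynomial.eval₂Hom_X']
      split_ifs <;> simp [mul_comm s]
  exact congrArg (fun φ => φ m) this

/-- A function with definable graph vanishing at a generic point vanishes near this point. -/
theorem eventually_eq_zero_of_generic {n : ℕ} {U : Set (Fin n → ℝ)} {f : (Fin n → ℝ) → ℝ}
    {D : Set ℝ} (hdef : DefinableGraphWithParams n D U f) {t : Fin n → ℝ} (ht : t ∈ U)
    (hft : f t = 0)
    (hind : ∀ q : MvPolynomial (Fin n) ℝ,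
      (∀ e : Fin n →₀ ℕ, MvPolynomial.coeff e q ∈ Subfield.closure D) →
      MvPolynomial.eval t q = 0 → q = 0) :
    ∀ᶠ x in 𝓝 t, f x = 0 := by
  obtain ⟨θ, params, hparams, hθ⟩ := hdef
  obtain ⟨M, hM⟩ := θ.exists_finset_realize_iff
  have hparams' : ∀ i, params i ∈ Subfield.closure D := fun i => by
    rcases hparams i with h | h
    · exact Subfield.subset_closure h
    · rw [h]; exact zero_mem _
  have hev : ∀ᶠ x in 𝓝 t, ∀ m ∈ M,
      SignType.sign (valuationHom (graphValuation params x 0) m) =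
        SignType.sign (valuationHom (graphValuation params t 0) m) := by
    refine (Finset.eventually_all M).2 fun m _ => ?_
    obtain ⟨q, hqD, hq⟩ := exists_mvPolynomial_eval_eq (n := n) _ hparams' m
    simp only [← hq]
    by_cases h0 : q = 0
    · simp [h0]
    · exact eventually_sign_eq (MvPolynomial.continuous_eval q).continuousAt
        fun h => h0 (hind q hqD h)
  filter_upwards [hev] with x hx
  exact ((hθ x 0).2 ((hM _ _ hx).2 ((hθ t 0).1 ⟨ht, hft⟩))).2

/-- A function with definable graph satisfies a polynomial equation along any line. -/
theorem DefinableGraphWithParams.exists_evalEval_eq_zero {n : ℕ} {U : Set (Fin n → ℝ)}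
    {f : (Fin n → ℝ) → ℝ} {D : Set ℝ} (hdef : DefinableGraphWithParams n D U f)
    (v w : Fin n → ℝ) :
    ∃ Q : ℝ[X][X], Q ≠ 0 ∧ ∀ s : ℝ, v + s • w ∈ U → Q.evalEval s (f (v + s • w)) = 0 := by
  classical
  obtain ⟨θ, params, -, hθ⟩ := hdef
  obtain ⟨M, hM⟩ := θ.exists_finset_realize_iff
  choose Q hQ using exists_polynomial_evalEval_eq params v w
  refine ⟨∏ m ∈ M with Q m ≠ 0, Q m,
    Finset.prod_ne_zero_iff.2 fun m hm => (Finset.mem_filter.1 hm).2, fun s hs => ?_⟩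
  by_contra hne
  rw [← coe_evalEvalRingHom, map_prod, ← ne_eq, Finset.prod_ne_zero_iff] at hne
  have hev : ∀ᶠ y in 𝓝 (f (v + s • w)), ∀ m ∈ M,
      SignType.sign (valuationHom (graphValuation params (v + s • w) y) m) =
        SignType.sign (valuationHom (graphValuation params (v + s • w) (f (v + s • w))) m) := by
    refine (Finset.eventually_all M).2 fun m hm => ?_
    simp only [← hQ]
    by_cases h0 : Q m = 0
    · simp [h0]
    · exact eventually_sign_eq ((continuous_evalEval (Q m)).comp
        (Continuous.prodMk_right s)).continuousAt (hne m (Finset.mem_filter.2 ⟨hm, h0⟩))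
  have heq : ∀ᶠ y in 𝓝[≠] (f (v + s • w)), f (v + s • w) = y := by
    filter_upwards [nhdsWithin_le_nhds hev] with y hy
    exact ((hθ _ y).2 ((hM _ _ hy).2 ((hθ _ _).1 ⟨hs, rfl⟩))).2
  obtain ⟨y, hy, hne'⟩ := (heq.and self_mem_nhdsWithin).exists
  exact hne' hy.symm

/-- Identity theorem for Nash functions. -/
theorem eq_zero_on_of_definable {n : ℕ} {U : Set (Fin n → ℝ)} (hU : IsOpen U)
    (hconn : IsPreconnected U) {f : (Fin n → ℝ) → ℝ} (hf : ContDiffOn ℝ (⊤ : ℕ∞) f U) {D : Set ℝ}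
    (hdef : DefinableGraphWithParams n D U f) {t : Fin n → ℝ} (ht : t ∈ U)
    (hzero : ∀ᶠ x in 𝓝 t, f x = 0) : ∀ x ∈ U, f x = 0 := by
  have hV : IsOpen {x | ∀ᶠ y in 𝓝 x, f y = 0} := isOpen_setOfPred_eventually_nhds
  have hsub := hconn.subset_of_closure_inter_subset hV ⟨t, ht, hzero⟩ (by
    rintro p ⟨hpV, hpU⟩
    obtain ⟨r, hr, hball⟩ := Metric.isOpen_iff.1 hU p hpU
    obtain ⟨v, hvB, hv⟩ := mem_closure_iff.1 hpV _ Metric.isOpen_ball (Metric.mem_ball_self hr)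
    filter_upwards [Metric.ball_mem_nhds p hr] with q hq
    let γ : ℝ → Fin n → ℝ := fun s => v + s • (q - v)
    have hγ : ContDiff ℝ (⊤ : ℕ∞) γ := contDiff_const.add (contDiff_id.smul contDiff_const)
    obtain ⟨Q, hQ0, hQ⟩ := hdef.exists_evalEval_eq_zero v (q - v)
    have hpre : IsPreconnected (γ ⁻¹' Metric.ball p r) := by
      refine Convex.isPreconnected ?_
      have : γ = AffineMap.lineMap v q := by
        ext s i
        simp [γ, AffineMap.lineMap_apply, add_comm]
      rw [this]
      exact (convex_ball p r).affine_preimage _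
    have hγ0 : ∀ᶠ s in 𝓝 (0 : ℝ), f (γ s) = 0 := by
      have hv' : ∀ᶠ y in 𝓝 (γ 0), f y = 0 := by simpa [γ] using hv
      exact hγ.continuous.continuousAt.eventually hv'
    have h := eq_zero_on_of_evalEval_eq_zero hQ0 (g := f ∘ γ)
      (Metric.isOpen_ball.preimage hγ.continuous) hpre
      (hf.comp hγ.contDiffOn fun s hs => hball hs) (fun s hs => hQ s (hball hs))
      (x₀ := 0) (by simpa [γ] using hvB) hγ0 1 (by simpa [γ] using hq)
    simpa [γ] using h)
  exact fun x hx => (show ∀ᶠ y in 𝓝 x, f y = 0 from hsub hx).self_of_nhds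

end NashVanishing

/-- Lemma 1.6: a Nash function on a connected open set `U ⊆ ℝ^n`, definable with
parameters from `D` and vanishing at a point of `U` whose coordinates are
algebraically independent over the subfield generated by `D`, vanishes on all of `U`. -/
theorem nash_vanishes (n : ℕ) (U : Set (Fin n → ℝ)) (hUopen : IsOpen U)
    (hUconn : IsConnected U) (f : (Fin n → ℝ) → ℝ)
    (hsmooth : ContDiffOn ℝ (⊤ : ℕ∞) f U) (D : Set ℝ)
    (hdef : DefinableGraphWithParams n D U f)
    (t : Fin n → ℝ) (ht : t ∈ U) (hft : f t = 0)
    (hind : ∀ q : MvPolynomial (Fin n) ℝ,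
      (∀ e : Fin n →₀ ℕ, MvPolynomial.coeff e q ∈ Subfield.closure D) →
      MvPolynomial.eval t q = 0 → q = 0) :
    ∀ x ∈ U, f x = 0 := by
  exact eq_zero_on_of_definable hUopen hUconn.isPreconnected hsmooth hdef ht
    (eventually_eq_zero_of_generic hdef ht hft hind)
end
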